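/- Let Γ be a finite simple graph, A(Γ) the right-angled Artin group defined by Γ, g ∈ A(Γ), and n > 0. Let w be a cyclically reduced word in the generators of A(Γ) and their inverses representing the conjugacy class of g^n. If u is a word such that both u and u⁻¹ appear as subwords of w considered as a cyclic word, then the length of u satisfies |u| ≤ |w|/(2n). -/

import Mathlib

/-- The defining relators of a right-angled Artin group: one commutator for each
edge of the graph. -/
def raagRels {V : Type*} (Γ : SimpleGraph V) : Set (FreeGroup V) :=
  {r | ∃ a b : V, Γ.Adj a b ∧
    r = FreeGroup.of a * FreeGroup.of b * (FreeGroup.of a)⁻¹ * (FreeGroup.of b)⁻¹}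

/-- The right-angled Artin group defined by the graph `Γ`. -/
abbrev RAAG {V : Type*} (Γ : SimpleGraph V) : Type _ :=
  PresentedGroup (raagRels Γ)

/-- The element of the right-angled Artin group spelled by a word in the
generators and their inverses (a letter `(a, tt)` stands for `a`, and
`(a, ff)` stands for `a⁻¹`). -/
def spellRAAG {V : Type*} (Γ : SimpleGraph V) (w : List (V × Bool)) : RAAG Γ :=
  PresentedGroup.mk (raagRels Γ) (FreeGroup.mk w)

/-- The formal inverse of a word: reverse it and invert each letter. -/
def wordInv {V : Type*} (w : List (V × Bool)) : List (V × Bool) :=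
  (w.map fun p => (p.1, !p.2)).reverse

/-- `u` appears as a subword of `w` considered as a cyclic word: `u` is a
contiguous subword of some cyclic permutation of `w`. -/
def IsCyclicSubword {V : Type*} (u w : List (V × Bool)) : Prop :=
  ∃ k : ℕ, u <:+: w.rotate k

namespace RAAG

variable {V : Type*}

/-- The subgroup generated by the link of the vertex `a`. -/
def linkSubgroup (Γ : SimpleGraph V) (a : V) : Subgroup (RAAG Γ) :=
  Subgroup.closure {x | ∃ b, Γ.Adj a b ∧ x = PresentedGroup.of b}

/-- The hyperplanes of the right-angled Artin group: a label `a` together with a coset of the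
subgroup generated by the link of `a`. -/
abbrev Hyperplane (Γ : SimpleGraph V) : Type _ :=
  Σ a : V, RAAG Γ ⧸ linkSubgroup Γ a

variable {Γ : SimpleGraph V}

/-- The hyperplane dual to the edge from `1` to the generator `a`. -/
def baseHyperplane (Γ : SimpleGraph V) (a : V) : Hyperplane Γ :=
  ⟨a, ((1 : RAAG Γ) : RAAG Γ ⧸ linkSubgroup Γ a)⟩

theorem smul_baseHyperplane_eq_iff (x y : RAAG Γ) (a : V) :
    x • baseHyperplane Γ a = y • baseHyperplane Γ a ↔ x⁻¹ * y ∈ linkSubgroup Γ a := by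
  rw [← QuotientGroup.eq]
  have h : ∀ z : RAAG Γ, z • baseHyperplane Γ a =
      ⟨a, (z : RAAG Γ ⧸ linkSubgroup Γ a)⟩ := by
    intro z
    have : z • ((1 : RAAG Γ) : RAAG Γ ⧸ linkSubgroup Γ a) =
        ((z * 1 : RAAG Γ) : RAAG Γ ⧸ linkSubgroup Γ a) := rfl
    rw [mul_one] at this
    rw [← this]; rfl
  rw [h, h]
  constructor
  · intro e; exact eq_of_heq (Sigma.mk.inj e).2
  · intro e; rw [e]

theorem of_smul_baseHyperplane {a b : V} (h : Γ.Adj a b) :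
    (PresentedGroup.of b : RAAG Γ) • baseHyperplane Γ a = baseHyperplane Γ a := by
  have := (smul_baseHyperplane_eq_iff (Γ := Γ) (1 : RAAG Γ) (PresentedGroup.of b) a).2
    (by rw [inv_one, one_mul]; exact Subgroup.subset_closure ⟨b, h, rfl⟩)
  rw [← this, one_smul]

open Classical in
/-- The affine action of a generator on integer functions on hyperplanes. -/
noncomputable def generatorPerm (Γ : SimpleGraph V) (a : V) : Equiv.Perm (Hyperplane Γ → ℤ) where
  toFun F p := F ((PresentedGroup.of a : RAAG Γ)⁻¹ • p) + if p = baseHyperplane Γ a then 1 else 0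
  invFun F p := F ((PresentedGroup.of a : RAAG Γ) • p) -
    if (PresentedGroup.of a : RAAG Γ) • p = baseHyperplane Γ a then 1 else 0
  left_inv F := by funext p; simp
  right_inv F := by funext p; simp

theorem of_mul_of_comm {a b : V} (h : Γ.Adj a b) :
    (PresentedGroup.of a : RAAG Γ) * PresentedGroup.of b =
      PresentedGroup.of b * PresentedGroup.of a := by
  have h1 : PresentedGroup.mk (raagRels Γ) (FreeGroup.of a * FreeGroup.of b *
      (FreeGroup.of a)⁻¹ * (FreeGroup.of b)⁻¹) = 1 :=
    PresentedGroup.one_of_mem ⟨a, b, h, rfl⟩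
  simp only [map_mul, map_inv] at h1
  rw [mul_inv_eq_one, mul_inv_eq_iff_eq_mul] at h1
  exact h1

open Classical in
theorem generatorPerm_commute {a b : V} (h : Γ.Adj a b) :
    generatorPerm Γ a * generatorPerm Γ b = generatorPerm Γ b * generatorPerm Γ a := by
  have hc := of_mul_of_comm h
  ext F p
  have e1 : ((PresentedGroup.of a : RAAG Γ)⁻¹ • p = baseHyperplane Γ b) ↔
      p = baseHyperplane Γ b := by
    rw [inv_smul_eq_iff, of_smul_baseHyperplane h.symm]
  have e2 : ((PresentedGroup.of b : RAAG Γ)⁻¹ • p = baseHyperplane Γ a) ↔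
      p = baseHyperplane Γ a := by
    rw [inv_smul_eq_iff, of_smul_baseHyperplane h]
  simp only [Equiv.Perm.mul_apply, generatorPerm, Equiv.coe_fn_mk, smul_smul,
    ← mul_inv_rev, hc]
  rw [if_congr e1 rfl rfl, if_congr e2 rfl rfl]
  ring

/-- The affine action of the group on integer functions on hyperplanes. -/
noncomputable def affineAction (Γ : SimpleGraph V) :
    RAAG Γ →* Equiv.Perm (Hyperplane Γ → ℤ) :=
  PresentedGroup.toGroup (f := generatorPerm Γ) (by
    rintro r ⟨a, b, h, rfl⟩
    simp only [map_mul, map_inv, FreeGroup.lift_apply_of]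
    rw [mul_inv_eq_one, mul_inv_eq_iff_eq_mul]
    exact generatorPerm_commute h)

/-- The signed number of times a path from `1` to `g` crosses a hyperplane. -/
noncomputable def crossing (g : RAAG Γ) (p : Hyperplane Γ) : ℤ := affineAction Γ g 0 p

theorem induction_generators {P : RAAG Γ → Prop} (one : P 1)
    (of : ∀ a, P (PresentedGroup.of a)) (mul : ∀ x y, P x → P y → P (x * y))
    (inv : ∀ x, P x → P x⁻¹) (x : RAAG Γ) : P x := by
  have hx : x ∈ Subgroup.closure (Set.range (PresentedGroup.of (rels := raagRels Γ))) := by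
    rw [PresentedGroup.closure_range_of]; trivial
  induction hx using Subgroup.closure_induction with
  | mem x hx => obtain ⟨a, rfl⟩ := hx; exact of a
  | one => exact one
  | mul x y _ _ hx hy => exact mul x y hx hy
  | inv x _ hx => exact inv x hx

theorem affineAction_apply (g : RAAG Γ) (F : Hyperplane Γ → ℤ) (p : Hyperplane Γ) :
    affineAction Γ g F p = crossing g p + F (g⁻¹ • p) := by
  revert F p
  induction g using induction_generators with
  | one => intro F p; simp [crossing]
  | of a =>
    intro F p
    simp [crossing, affineAction, PresentedGroup.toGroup.of, generatorPerm, add_comm]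
  | mul x y hx hy =>
    intro F p
    unfold crossing
    rw [map_mul, Equiv.Perm.mul_apply, Equiv.Perm.mul_apply, hx, hx (affineAction Γ y 0), hy,
      mul_inv_rev, mul_smul]
    unfold crossing; ring
  | inv x hx =>
    intro F p
    have key : ∀ G : Hyperplane Γ → ℤ,
        affineAction Γ x⁻¹ G p = G (x • p) - crossing x (x • p) := by
      intro G
      have h1 := hx (affineAction Γ x⁻¹ G) (x • p)
      rw [← Equiv.Perm.mul_apply, ← map_mul, mul_inv_cancel, map_one, inv_smul_smul] at h1
      simp only [Equiv.Perm.one_apply] at h1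
      linarith
    rw [crossing, key, key, inv_inv, Pi.zero_apply]
    ring

theorem crossing_mul (g h : RAAG Γ) (p : Hyperplane Γ) :
    crossing (g * h) p = crossing g p + crossing h (g⁻¹ • p) := by
  rw [crossing, map_mul, Equiv.Perm.mul_apply, affineAction_apply]; rfl

@[simp] theorem crossing_one (p : Hyperplane Γ) : crossing (1 : RAAG Γ) p = 0 := by
  simp [crossing]

theorem crossing_inv (g : RAAG Γ) (p : Hyperplane Γ) :
    crossing g⁻¹ p = - crossing g (g • p) := by
  have := crossing_mul g⁻¹ g p
  rw [inv_mul_cancel, crossing_one, inv_inv] at this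
  linarith

open Classical in
theorem crossing_of (a : V) (p : Hyperplane Γ) :
    crossing (PresentedGroup.of a : RAAG Γ) p = if p = baseHyperplane Γ a then 1 else 0 := by
  simp [crossing, affineAction, PresentedGroup.toGroup.of, generatorPerm]

theorem crossing_smul (g x : RAAG Γ) (p : Hyperplane Γ) :
    crossing (g * x) (g • p) = crossing g (g • p) + crossing x p := by
  rw [crossing_mul, inv_smul_smul]

theorem crossing_linkSubgroup {a : V} {y : RAAG Γ} (hy : y ∈ linkSubgroup Γ a)
    (p : Hyperplane Γ) (hp : ¬ Γ.Adj a p.1) : crossing y p = 0 := by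
  revert p
  induction hy using Subgroup.closure_induction with
  | mem x hx =>
    obtain ⟨b, hb, rfl⟩ := hx
    intro p hp
    rw [crossing_of, if_neg]
    rintro rfl
    exact hp hb
  | one => intro p _; simp
  | mul x y _ _ hx hy =>
    intro p hp
    rw [crossing_mul, hx p hp, hy (x⁻¹ • p) hp, add_zero]
  | inv x _ hx =>
    intro p hp
    rw [crossing_inv, hx (x • p) hp, neg_zero]

theorem of_notMem_linkSubgroup (a : V) :
    (PresentedGroup.of a : RAAG Γ) ∉ linkSubgroup Γ a := by
  intro h
  have := crossing_linkSubgroup h (baseHyperplane Γ a) (Γ.loopless.irrefl a)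
  simp [crossing_of] at this

theorem crossing_eq_of_smul_eq {x y : RAAG Γ} {a : V}
    (h : x • baseHyperplane Γ a = y • baseHyperplane Γ a) (p : Hyperplane Γ)
    (hp : ¬ Γ.Adj a p.1) : crossing x p = crossing y p := by
  rw [smul_baseHyperplane_eq_iff] at h
  have := crossing_mul x (x⁻¹ * y) p
  rw [mul_inv_cancel_left, crossing_linkSubgroup h (x⁻¹ • p) hp] at this
  linarith

theorem finite_crossing_ne_zero (g : RAAG Γ) : {p | crossing g p ≠ 0}.Finite := by
  induction g using induction_generators with
  | one => simp
  | of a =>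
    refine (Set.finite_singleton (baseHyperplane Γ a)).subset fun p hp => ?_
    by_contra h
    exact hp ((crossing_of a p).trans (if_neg h))
  | mul x y hx hy =>
    refine (hx.union (hy.image (x • ·))).subset fun p hp => ?_
    by_contra h
    rw [Set.mem_union, not_or] at h
    apply hp
    have h1 : crossing x p = 0 := by simpa using h.1
    have h2 : crossing y (x⁻¹ • p) = 0 := by
      by_contra h3
      exact h.2 ⟨x⁻¹ • p, h3, smul_inv_smul x p⟩
    rw [crossing_mul, h1, h2, add_zero]
  | inv x hx =>
    refine (hx.image (x⁻¹ • ·)).subset fun p hp => ?_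
    refine ⟨x • p, fun h => hp ?_, inv_smul_smul x p⟩
    rw [crossing_inv, h, neg_zero]

/-- The group element spelled by a single letter. -/
def letter (Γ : SimpleGraph V) (l : V × Bool) : RAAG Γ :=
  if l.2 then PresentedGroup.of l.1 else (PresentedGroup.of l.1)⁻¹

/-- The sign of a letter. -/
def letterSign (l : V × Bool) : ℤ := if l.2 then 1 else -1

theorem letterSign_ne_zero (l : V × Bool) : letterSign l ≠ 0 := by
  unfold letterSign; split <;> decide

theorem letterSign_injective {l m : V × Bool} (h1 : l.1 = m.1)
    (h2 : letterSign l = letterSign m) : l = m := by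
  obtain ⟨a, s⟩ := l
  obtain ⟨b, t⟩ := m
  cases s <;> cases t <;> simp_all [letterSign]

/-- The endpoint of the `i`-th edge of a path at which the edge, oriented by its generator,
starts. -/
def dualVertex (X : ℤ → RAAG Γ) (W : ℤ → V × Bool) (i : ℤ) : RAAG Γ :=
  if (W i).2 then X i else X (i + 1)

/-- The hyperplane dual to the `i`-th edge of a path. -/
def dualHyperplane (X : ℤ → RAAG Γ) (W : ℤ → V × Bool) (i : ℤ) : Hyperplane Γ :=
  dualVertex X W i • baseHyperplane Γ (W i).1

theorem dualVertex_eq_or (X : ℤ → RAAG Γ) (W : ℤ → V × Bool) (i : ℤ) :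
    dualVertex X W i = X i ∨ dualVertex X W i = X (i + 1) := by
  unfold dualVertex; split <;> simp

section Path

variable {X : ℤ → RAAG Γ} {W : ℤ → V × Bool} (hX : ∀ i, X (i + 1) = X i * letter Γ (W i))

include hX

open Classical in
theorem crossing_step (i : ℤ) (p : Hyperplane Γ) :
    crossing (X (i + 1)) p =
      crossing (X i) p + if p = dualHyperplane X W i then letterSign (W i) else 0 := by
  have h := hX i
  unfold letter at h
  unfold dualHyperplane dualVertex letterSign
  split_ifs at h ⊢ with h1 h2 h2
  · rw [h, crossing_mul, crossing_of, if_pos]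
    rw [h2, inv_smul_smul]
  · rw [h, crossing_mul, crossing_of, if_neg]
    rwa [inv_smul_eq_iff]
  · have h' : X i = X (i + 1) * PresentedGroup.of (W i).1 := by rw [h, inv_mul_cancel_right]
    rw [h', crossing_mul, crossing_of, if_pos]
    · ring
    · rw [h2, inv_smul_smul]
  · have h' : X i = X (i + 1) * PresentedGroup.of (W i).1 := by rw [h, inv_mul_cancel_right]
    rw [h', crossing_mul, crossing_of, if_neg]
    · ring
    · rwa [inv_smul_eq_iff]

theorem crossing_eq_of_forall_ne {i j : ℤ} (hij : i ≤ j) {p : Hyperplane Γ}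
    (h : ∀ k, i ≤ k → k < j → p ≠ dualHyperplane X W k) :
    crossing (X j) p = crossing (X i) p := by
  induction j, hij using Int.leInduction with
  | base => rfl
  | succ j hij ih =>
    rw [crossing_step hX, if_neg (h j hij (by lia)), add_zero]
    exact ih fun k h1 h2 => h k h1 (by lia)

theorem crossing_dualHyperplane {i k j : ℤ} (hik : i ≤ k) (hkj : k < j)
    (h : ∀ l, i ≤ l → l < j → l ≠ k → dualHyperplane X W k ≠ dualHyperplane X W l) :
    crossing (X j) (dualHyperplane X W k) =
      crossing (X i) (dualHyperplane X W k) + letterSign (W k) := by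
  rw [crossing_eq_of_forall_ne hX (i := k + 1) (by lia)
      (fun l h1 h2 => h l (by lia) h2 (by lia)),
    crossing_step hX, if_pos rfl, crossing_eq_of_forall_ne hX hik
      (fun l h1 h2 => h l h1 (by lia) (by lia))]

theorem crossing_dualVertex {i : ℤ} {p : Hyperplane Γ} (h : p ≠ dualHyperplane X W i) :
    crossing (dualVertex X W i) p = crossing (X i) p := by
  rcases dualVertex_eq_or X W i with h' | h'
  · rw [h']
  · rw [h', crossing_step hX, if_neg h, add_zero]

theorem mem_linkSubgroup_of_forall_adj {a : V} {i j : ℤ} (hij : i ≤ j)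
    (h : ∀ k, i ≤ k → k < j → Γ.Adj a (W k).1) : (X i)⁻¹ * X j ∈ linkSubgroup Γ a := by
  induction j, hij using Int.leInduction with
  | base => simp
  | succ j hij ih =>
    rw [hX, ← mul_assoc]
    refine mul_mem (ih fun k h1 h2 => h k h1 (by lia)) ?_
    have : (PresentedGroup.of (W j).1 : RAAG Γ) ∈ linkSubgroup Γ a :=
      Subgroup.subset_closure ⟨_, h j hij (by lia), rfl⟩
    unfold letter
    split
    · exact this
    · exact inv_mem this

end Path

/-- The word of length `k` read from position `i` on. -/
def segment (W : ℤ → V × Bool) (i : ℤ) (k : ℕ) : List (V × Bool) :=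
  (List.range k).map fun t => W (i + t)

theorem length_segment (W : ℤ → V × Bool) (i : ℤ) (k : ℕ) : (segment W i k).length = k := by
  simp [segment]

theorem spellRAAG_append (v w : List (V × Bool)) :
    spellRAAG Γ (v ++ w) = spellRAAG Γ v * spellRAAG Γ w := by
  simp only [spellRAAG, ← FreeGroup.mul_mk, map_mul]

theorem spellRAAG_singleton (l : V × Bool) : spellRAAG Γ [l] = letter Γ l := by
  obtain ⟨a, s⟩ := l
  cases s
  · have : FreeGroup.mk [(a, false)] = (FreeGroup.of a)⁻¹ := by
      simp [FreeGroup.of, FreeGroup.invRev]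
    simp only [spellRAAG, letter, this, map_inv]
    rfl
  · rfl

theorem spellRAAG_nil : spellRAAG Γ ([] : List (V × Bool)) = 1 := by
  simp [spellRAAG, ← FreeGroup.one_eq_mk]

section Path

variable {X : ℤ → RAAG Γ} {W : ℤ → V × Bool} (hX : ∀ i, X (i + 1) = X i * letter Γ (W i))

include hX

theorem spellRAAG_segment (i : ℤ) (k : ℕ) :
    spellRAAG Γ (segment W i k) = (X i)⁻¹ * X (i + k) := by
  induction k with
  | zero => simp [segment, spellRAAG_nil]
  | succ k ih =>
    have : segment W i (k + 1) = segment W i k ++ [W (i + k)] := by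
      simp [segment, List.range_succ]
    rw [this, spellRAAG_append, ih, spellRAAG_singleton, mul_assoc, ← hX]
    push_cast
    rw [add_assoc]

theorem inv_mul_succ_eq_of_forall_adj {i j : ℤ} (hij : i < j) (h1 : (W i).1 = (W j).1)
    (h2 : (W i).2 ≠ (W j).2) (h : ∀ k, i < k → k < j → Γ.Adj (W i).1 (W k).1) :
    (X i)⁻¹ * X (j + 1) = (X (i + 1))⁻¹ * X j := by
  have hy := mem_linkSubgroup_of_forall_adj hX (i := i + 1) (j := j) (a := (W i).1) (by lia)
    fun k h3 h4 => h k (by lia) h4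
  have hle : linkSubgroup Γ (W i).1 ≤ Subgroup.centralizer {PresentedGroup.of (W i).1} := by
    refine (Subgroup.closure_le _).2 ?_
    rintro _ ⟨b, hb, rfl⟩
    rw [SetLike.mem_coe, Subgroup.mem_centralizer_singleton_iff]
    exact (of_mul_of_comm hb).symm
  have hc : Commute (PresentedGroup.of (W i).1) ((X (i + 1))⁻¹ * X j) :=
    (Subgroup.mem_centralizer_singleton_iff.1 (hle hy)).symm
  have hc' : Commute (letter Γ (W i)) ((X (i + 1))⁻¹ * X j) := by
    unfold letter
    split
    · exact hc
    · exact hc.inv_left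
  have hl : letter Γ (W j) = (letter Γ (W i))⁻¹ := by
    unfold letter
    rw [← h1]
    rcases hsi : (W i).2 <;> rcases hsj : (W j).2 <;> simp_all
  have e1 : X i = X (i + 1) * (letter Γ (W i))⁻¹ := by rw [hX, mul_inv_cancel_right]
  rw [e1, hX j, hl, mul_inv_rev, inv_inv, mul_assoc, ← mul_assoc _ (X j), ← mul_assoc,
    hc'.eq, mul_inv_cancel_right]

theorem dualHyperplane_eq_of_forall_adj {i j : ℤ} (hij : i < j) (h1 : (W i).1 = (W j).1)
    (h2 : (W i).2 ≠ (W j).2) (h : ∀ k, i < k → k < j → Γ.Adj (W i).1 (W k).1) :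
    dualHyperplane X W i = dualHyperplane X W j := by
  have hy := mem_linkSubgroup_of_forall_adj hX (i := i + 1) (j := j) (a := (W i).1) (by lia)
    fun k h3 h4 => h k (by lia) h4
  have e := inv_mul_succ_eq_of_forall_adj hX hij h1 h2 h
  unfold dualHyperplane
  rw [← h1, smul_baseHyperplane_eq_iff]
  rcases hsi : (W i).2 <;> rcases hsj : (W j).2 <;>
    simp_all [dualVertex]

theorem dualHyperplane_injective {N : ℕ} (hN : 0 < N) (hW : ∀ i, W (i + N) = W i)
    (hcr : ∀ i w', IsConj ((X i)⁻¹ * X (i + N)) (spellRAAG Γ w') → N ≤ w'.length) :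
    Function.Injective (dualHyperplane X W) := by
  have key : ∀ d : ℕ, ∀ i : ℤ, dualHyperplane X W i ≠ dualHyperplane X W (i + (d + 1 : ℕ)) := by
    intro d
    induction d using Nat.strong_induction_on with
    | _ d ih =>
    intro i heq
    obtain ⟨j, hj⟩ : ∃ j, j = i + (d + 1 : ℕ) := ⟨_, rfl⟩
    rw [← hj] at heq
    have ih' : ∀ k l, k < l → l - k < j - i → dualHyperplane X W k ≠ dualHyperplane X W l := by
      intro k l h1 h2
      have := ih (l - k - 1).toNat (by lia) k
      rwa [show k + (((l - k - 1).toNat + 1 : ℕ) : ℤ) = l by lia] at this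
    have hlab : (W i).1 = (W j).1 := congrArg Sigma.fst heq
    have hadj : ∀ k, i < k → k < j → Γ.Adj (W i).1 (W k).1 := by
      intro k h1 h2
      by_contra hna
      have e1 := crossing_dualHyperplane hX (i := i + 1) (k := k) (j := j) (by lia) h2
        (fun l h3 h4 h5 => by
          rcases lt_or_gt_of_ne h5 with h6 | h6
          · exact (ih' l k h6 (by lia)).symm
          · exact ih' k l h6 (by lia))
      have e2 : crossing (X (i + 1)) (dualHyperplane X W k) =
          crossing (X i) (dualHyperplane X W k) := by
        rw [crossing_step hX, if_neg (ih' i k h1 (by lia)).symm, add_zero]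
      have hik := (ih' i k h1 (by lia)).symm
      have hjk := ih' k j h2 (by lia)
      have e3 : crossing (dualVertex X W i) (dualHyperplane X W k) =
          crossing (dualVertex X W j) (dualHyperplane X W k) := by
        apply crossing_eq_of_smul_eq (a := (W i).1) _ _ hna
        have := heq
        unfold dualHyperplane at this
        rwa [← hlab] at this
      rw [crossing_dualVertex hX hik, crossing_dualVertex hX hjk] at e3
      exact letterSign_ne_zero (W k) (by lia)
    have hy := mem_linkSubgroup_of_forall_adj hX (i := i + 1) (j := j) (a := (W i).1) (by lia)
      fun k h1 h2 => hadj k (by lia) h2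
    have hmem : (dualVertex X W i)⁻¹ * dualVertex X W j ∈ linkSubgroup Γ (W i).1 := by
      rw [← smul_baseHyperplane_eq_iff]
      have := heq
      unfold dualHyperplane at this
      rwa [← hlab] at this
    have hi := hX i
    have hj' := hX j
    have hsign : (W i).2 ≠ (W j).2 := by
      intro hs
      unfold letter at hi hj'
      apply of_notMem_linkSubgroup (Γ := Γ) (W i).1
      rcases hsi : (W i).2 <;> rw [hsi] at hs <;>
        simp only [dualVertex, hsi, ← hs, Bool.false_eq_true, if_false, if_true] at hmem hi hj'
      · rw [← hlab] at hj'
        rw [hj', ← mul_assoc] at hmem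
        have := (Subgroup.mul_mem_cancel_left _ hy).1 hmem
        exact inv_mem_iff.1 this
      · have e : (X i)⁻¹ * X j = PresentedGroup.of (W i).1 * ((X (i + 1))⁻¹ * X j) := by
          rw [hi]; group
        rw [e] at hmem
        exact (Subgroup.mul_mem_cancel_right _ hy).1 hmem
    rcases lt_trichotomy (i + N) j with h | h | h
    · have := hadj (i + N) (by lia) h
      rw [hW] at this
      exact Γ.loopless.irrefl _ this
    · rw [← h, hW] at hsign
      exact hsign rfl
    · obtain ⟨m, hm⟩ : ∃ m : ℕ, (m : ℤ) = j - (i + 1) := ⟨(j - (i + 1)).toNat, by lia⟩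
      obtain ⟨m', hm'⟩ : ∃ m' : ℕ, (m' : ℤ) = i + N - (j + 1) :=
        ⟨(i + N - (j + 1)).toNat, by lia⟩
      have := hcr i (segment W (i + 1) m ++ segment W (j + 1) m') (by
        rw [spellRAAG_append, spellRAAG_segment hX, spellRAAG_segment hX, hm, hm',
          show i + 1 + (j - (i + 1)) = j by ring, show j + 1 + (i + N - (j + 1)) = i + N by ring]
        have e : (X i)⁻¹ * X (j + 1) = (X (i + 1))⁻¹ * X j :=
          inv_mul_succ_eq_of_forall_adj hX (by lia) hlab hsign hadj
        rw [← e]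
        have : (X i)⁻¹ * X (i + N) = (X i)⁻¹ * X (j + 1) * ((X (j + 1))⁻¹ * X (i + N)) := by group
        rw [← this])
      simp only [List.length_append, length_segment] at this
      lia
  intro i j h
  by_contra hne
  rcases lt_or_gt_of_ne hne with h1 | h1
  · have := key (j - i - 1).toNat i
    rw [show i + (((j - i - 1).toNat + 1 : ℕ) : ℤ) = j by lia] at this
    exact this h
  · have := key (i - j - 1).toNat j
    rw [show j + (((i - j - 1).toNat + 1 : ℕ) : ℤ) = i by lia] at this
    exact this h.symm

end Path

section Axis

variable {X : ℤ → RAAG Γ} {W : ℤ → V × Bool} {N : ℕ} {ω : RAAG Γ}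

theorem dualHyperplane_add (hW : ∀ i, W (i + N) = W i) (hω : ∀ i, X (i + N) = ω * X i) (i : ℤ) :
    dualHyperplane X W (i + N) = ω • dualHyperplane X W i := by
  unfold dualHyperplane dualVertex
  rw [hW, smul_smul, add_right_comm, hω, hω]
  split <;> rfl

theorem dualHyperplane_add_mul (hW : ∀ i, W (i + N) = W i) (hω : ∀ i, X (i + N) = ω * X i)
    (i k : ℤ) : dualHyperplane X W (i + k * N) = ω ^ k • dualHyperplane X W i := by
  induction k using Int.induction_on with
  | zero => simp
  | succ k ih =>
    rw [add_mul, one_mul, ← add_assoc, dualHyperplane_add hW hω, ih, smul_smul, ← zpow_one_add,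
      add_comm 1]
  | pred k ih =>
    have := dualHyperplane_add hW hω (i + (-(k : ℤ) - 1) * N)
    rw [show i + (-(k : ℤ) - 1) * N + N = i + -k * N by ring, ih, ← inv_smul_eq_iff, smul_smul]
      at this
    rw [← this, ← zpow_neg_one, ← zpow_add, add_comm, sub_eq_add_neg]

theorem path_mul (hω : ∀ i, X (i + N) = ω * X i) (hX0 : X 0 = 1) (k : ℤ) :
    X (k * N) = ω ^ k := by
  induction k using Int.induction_on with
  | zero => simp [hX0]
  | succ k ih =>
    rw [add_mul, one_mul, hω, ih, ← zpow_one_add, add_comm 1]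
  | pred k ih =>
    have := hω ((-(k : ℤ) - 1) * N)
    rw [show (-(k : ℤ) - 1) * N + N = -k * N by ring, ih, ← inv_mul_eq_iff_eq_mul] at this
    rw [← this, ← zpow_neg_one, ← zpow_add, add_comm, sub_eq_add_neg]

theorem exists_crossing_mul_eq (hN : 0 < N) (hW : ∀ i, W (i + N) = W i)
    (hω : ∀ i, X (i + N) = ω * X i) (hX0 : X 0 = 1)
    (hinj : Function.Injective (dualHyperplane X W)) {g : RAAG Γ} (hg : Commute g ω) (i : ℤ) :
    ∃ K : ℤ, ∀ k : ℤ, K ≤ |k| → crossing (g * X (k * N)) (g • dualHyperplane X W i) =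
      crossing (X (k * N)) (g • dualHyperplane X W i) := by
  have hfin : {k : ℤ | crossing g (g • dualHyperplane X W (i + -k * N)) ≠ 0}.Finite := by
    refine (finite_crossing_ne_zero g).preimage (Function.Injective.injOn fun k l hkl => ?_)
    have h1 := hinj (MulAction.injective g hkl)
    have h2 : (k - l) * (N : ℤ) = 0 := by linarith
    rcases mul_eq_zero.1 h2 with h3 | h3 <;> lia
  obtain ⟨K, hK⟩ := (hfin.image abs).bddAbove
  refine ⟨K + 1, fun k hk => ?_⟩
  have h0 : crossing g (g • dualHyperplane X W (i + -k * N)) = 0 := by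
    by_contra h
    have := hK ⟨k, h, rfl⟩
    lia
  rw [path_mul hω hX0, (hg.zpow_right k).eq, crossing_mul, smul_smul,
    ← zpow_neg, ((hg.zpow_right (-k)).symm).eq, mul_smul, ← dualHyperplane_add_mul hW hω, h0,
    add_zero]

theorem exists_bound_crossing_sub (hN : 0 < N) (hW : ∀ i, W (i + N) = W i)
    (hω : ∀ i, X (i + N) = ω * X i) (hX0 : X 0 = 1)
    (hinj : Function.Injective (dualHyperplane X W)) {g : RAAG Γ} (hg : Commute g ω) (i B : ℤ) :
    ∃ s t : ℤ, s ≤ -B ∧ B ≤ t ∧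
      crossing (g * X s) (g • dualHyperplane X W i) = crossing (X s) (g • dualHyperplane X W i) ∧
      crossing (g * X t) (g • dualHyperplane X W i) =
        crossing (X t) (g • dualHyperplane X W i) := by
  obtain ⟨K, hK⟩ := exists_crossing_mul_eq hN hW hω hX0 hinj hg i
  have hk : K ≤ |K| + |B| := by have := le_abs_self K; have := abs_nonneg B; lia
  have h0 : 0 ≤ |K| + |B| := by positivity
  have hb : B ≤ (|K| + |B|) * N := by
    have h1 : B ≤ |K| + |B| := by have := le_abs_self B; have := abs_nonneg K; lia
    have h2 : (1 : ℤ) ≤ N := by exact_mod_cast hN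
    nlinarith
  refine ⟨-(|K| + |B|) * N, (|K| + |B|) * N, by linarith, hb, hK _ ?_, hK _ ?_⟩
  · rwa [abs_neg, abs_of_nonneg h0]
  · rwa [abs_of_nonneg h0]

variable (hX : ∀ i, X (i + 1) = X i * letter Γ (W i))

include hX

theorem exists_smul_dualHyperplane_eq (hN : 0 < N) (hW : ∀ i, W (i + N) = W i)
    (hω : ∀ i, X (i + N) = ω * X i) (hX0 : X 0 = 1)
    (hinj : Function.Injective (dualHyperplane X W)) {g : RAAG Γ} (hg : Commute g ω) (i : ℤ) :
    ∃ j, g • dualHyperplane X W i = dualHyperplane X W j ∧ W j = W i := by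
  obtain ⟨s, t, hs, ht, h1, h2⟩ :=
    exists_bound_crossing_sub hN hW hω hX0 hinj hg i (|i| + 1)
  have hi1 := le_abs_self i
  have hi2 := neg_abs_le i
  have e := crossing_dualHyperplane hX (i := s) (k := i) (j := t) (by lia) (by lia)
    (fun l _ _ hl h => hl (hinj h).symm)
  rw [crossing_smul] at h1 h2
  have hne : crossing (X t) (g • dualHyperplane X W i) =
      crossing (X s) (g • dualHyperplane X W i) + letterSign (W i) := by linarith
  obtain ⟨j, hj1, hj2, hj⟩ : ∃ j, s ≤ j ∧ j < t ∧ g • dualHyperplane X W i =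
      dualHyperplane X W j := by
    by_contra hcon
    push Not at hcon
    have := crossing_eq_of_forall_ne hX (i := s) (j := t) (by lia) hcon
    exact letterSign_ne_zero (W i) (by lia)
  refine ⟨j, hj, ?_⟩
  have e' := crossing_dualHyperplane hX (i := s) (k := j) (j := t) hj1 hj2
    (fun l _ _ hl h => hl (hinj h).symm)
  rw [hj] at hne
  exact letterSign_injective (congrArg Sigma.fst hj).symm (by lia)

theorem lt_of_smul_dualHyperplane_eq (hN : 0 < N) (hW : ∀ i, W (i + N) = W i)
    (hω : ∀ i, X (i + N) = ω * X i) (hX0 : X 0 = 1)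
    (hinj : Function.Injective (dualHyperplane X W)) {g : RAAG Γ} (hg : Commute g ω)
    {i j i' j' : ℤ} (hi : g • dualHyperplane X W i = dualHyperplane X W i')
    (hj : g • dualHyperplane X W j = dualHyperplane X W j') (hij : i < j)
    (hadj : ¬ Γ.Adj (W j).1 (W i).1) : i' < j' := by
  obtain ⟨s, -, hs, -, h1, -⟩ :=
    exists_bound_crossing_sub hN hW hω hX0 hinj hg i (|i| + |i'| + |j'| + 1)
  have hi1 := neg_abs_le i
  have hi2 := neg_abs_le i'
  have hi3 := neg_abs_le j'
  have hi4 := abs_nonneg i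
  have hi5 := abs_nonneg i'
  have hi6 := abs_nonneg j'
  have hne : i' ≠ j' := by
    rintro rfl
    exact hij.ne (hinj (MulAction.injective g (hi.trans hj.symm)))
  by_contra hlt
  have e1 := crossing_dualHyperplane hX (i := s) (k := i) (j := j) (by lia) hij
    (fun l _ _ hl h => hl (hinj h).symm)
  rw [← crossing_dualVertex hX (fun h => hij.ne (hinj h))] at e1
  have e2 := crossing_eq_of_forall_ne hX (i := s) (j := j') (p := dualHyperplane X W i') (by lia)
    (fun k h2 h3 h => by have := hinj h; lia)
  rw [← crossing_dualVertex hX (fun h => hne (hinj h))] at e2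
  have hlab : (W j).1 = (W j').1 := congrArg Sigma.fst hj
  have e3 : crossing (g * dualVertex X W j) (dualHyperplane X W i') =
      crossing (dualVertex X W j') (dualHyperplane X W i') := by
    apply crossing_eq_of_smul_eq (a := (W j).1)
    · rw [mul_smul]
      have := hj
      unfold dualHyperplane at this
      rwa [← hlab] at this
    · rwa [← hi]
  rw [← hi, crossing_smul, hi] at e3
  rw [crossing_smul, hi] at h1
  exact letterSign_ne_zero (W i) (by linarith)

end Axis

section Combinatorics

open Classical in
/-- The signed number of letters with label `a` between the positions `0` and `i`. -/
noncomputable def labelCount (W : ℤ → V × Bool) (a : V) (i : ℤ) : ℤ :=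
  ∑ k ∈ Finset.Ico 0 i, (if (W k).1 = a then 1 else 0) -
    ∑ k ∈ Finset.Ico i 0, (if (W k).1 = a then 1 else 0)

variable {W : ℤ → V × Bool}

open Classical in
theorem labelCount_succ (a : V) (i : ℤ) :
    labelCount W a (i + 1) = labelCount W a i + if (W i).1 = a then 1 else 0 := by
  unfold labelCount
  rcases le_or_gt 0 i with h | h
  · rw [Finset.Ico_eq_empty_of_le (a := i) h, Finset.Ico_eq_empty_of_le (a := i + 1) (by lia),
      ← Finset.insert_Ico_right_eq_Ico_add_one h, Finset.sum_insert (by simp)]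
    ring
  · rw [Finset.Ico_eq_empty_of_le (b := i) h.le, Finset.Ico_eq_empty_of_le (b := i + 1) (by lia),
      ← Finset.insert_Ico_add_one_left_eq_Ico h, Finset.sum_insert (by simp)]
    ring

theorem labelCount_succ_of_eq {a : V} {i : ℤ} (h : (W i).1 = a) :
    labelCount W a (i + 1) = labelCount W a i + 1 := by
  rw [labelCount_succ, if_pos h]

theorem labelCount_mono (a : V) : Monotone (labelCount W a) := by
  refine monotone_int_of_le_succ fun i => ?_
  rw [labelCount_succ]
  split <;> lia

theorem labelCount_lt {a : V} {i j : ℤ} (h : (W i).1 = a) (hij : i < j) :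
    labelCount W a i < labelCount W a j := by
  have := labelCount_mono (W := W) a (show i + 1 ≤ j by lia)
  rw [labelCount_succ_of_eq h] at this
  lia

theorem eq_of_labelCount_eq {a : V} {i j : ℤ} (hi : (W i).1 = a) (hj : (W j).1 = a)
    (h : labelCount W a i = labelCount W a j) : i = j := by
  rcases lt_trichotomy i j with h1 | h1 | h1
  · exact absurd h (labelCount_lt hi h1).ne
  · exact h1
  · exact absurd h (labelCount_lt hj h1).ne'

theorem lt_of_labelCount_lt {a : V} {i j : ℤ} (h : labelCount W a i < labelCount W a j) :
    i < j := by
  by_contra h1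
  exact absurd (labelCount_mono (W := W) a (not_lt.1 h1)) (not_le.2 h)

theorem sum_labelCount_sub [Fintype V] (i : ℤ) (k : ℕ) :
    ∑ a, (labelCount W a (i + k) - labelCount W a i) = k := by
  classical
  induction k with
  | zero => simp
  | succ k ih =>
    have : ∀ a, labelCount W a (i + (k + 1 : ℕ)) - labelCount W a i =
        (labelCount W a (i + k) - labelCount W a i) + if (W (i + k)).1 = a then 1 else 0 := by
      intro a
      rw [show i + ((k + 1 : ℕ) : ℤ) = i + k + 1 by push_cast; ring, labelCount_succ]
      ring
    simp only [this, Finset.sum_add_distrib, ih, Finset.sum_ite_eq, Finset.mem_univ, if_true]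
    push_cast; ring

theorem labelCount_add {N : ℤ} (hW : ∀ i, W (i + N) = W i) (a : V) (i : ℤ) :
    labelCount W a (i + N) = labelCount W a i + (labelCount W a N - labelCount W a 0) := by
  induction i using Int.induction_on with
  | zero => rw [zero_add]; ring
  | succ i ih => rw [add_right_comm, labelCount_succ, labelCount_succ, hW, ih]; ring
  | pred i ih =>
    have h1 := labelCount_succ (W := W) a (-(i : ℤ) - 1 + N)
    have h2 := labelCount_succ (W := W) a (-(i : ℤ) - 1)
    rw [hW] at h1
    rw [show -(i : ℤ) - 1 + N + 1 = -i + N by ring] at h1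
    rw [sub_add_cancel] at h2
    linarith

theorem labelCount_add_mul {N : ℤ} (hW : ∀ i, W (i + N) = W i) (a : V) (i t : ℤ) :
    labelCount W a (i + t * N) =
      labelCount W a i + t * (labelCount W a N - labelCount W a 0) := by
  induction t using Int.induction_on with
  | zero => simp
  | succ t ih => rw [add_mul, one_mul, ← add_assoc, labelCount_add hW, ih]; ring
  | pred t ih =>
    have h1 := labelCount_add hW a (i + (-(t : ℤ) - 1) * N)
    rw [show i + (-(t : ℤ) - 1) * N + N = i + -t * N by ring, ih] at h1
    linarith

theorem exists_labelCount_eq {N : ℤ} (hW : ∀ i, W (i + N) = W i) {a : V}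
    (ha : 0 < labelCount W a N - labelCount W a 0) (x : ℤ) :
    ∃ i, (W i).1 = a ∧ labelCount W a i = x := by
  set M := labelCount W a N - labelCount W a 0
  have hM : ∀ t, labelCount W a (t * N) = labelCount W a 0 + t * M := fun t => by
    simpa using labelCount_add_mul hW a 0 t
  obtain ⟨i, hi, hmax⟩ := Int.exists_greatest_of_bdd (P := fun i => labelCount W a i ≤ x)
    ⟨(|x - labelCount W a 0| + 1) * N, fun i hi => by
      by_contra h
      have h1 := labelCount_mono (W := W) a (not_le.1 h).le
      rw [hM] at h1
      have h2 := le_abs_self (x - labelCount W a 0)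
      have h3 := abs_nonneg (x - labelCount W a 0)
      nlinarith⟩
    ⟨-|x - labelCount W a 0| * N, by
      rw [hM]
      have h2 := neg_abs_le (x - labelCount W a 0)
      have h3 := abs_nonneg (x - labelCount W a 0)
      nlinarith⟩
  have h1 : x < labelCount W a (i + 1) := by
    by_contra h
    have := hmax (i + 1) (not_lt.1 h)
    lia
  rw [labelCount_succ] at h1
  split_ifs at h1 with h2
  · exact ⟨i, h2, by lia⟩
  · lia

/-- An order automorphism of the positions with a given label shifts their enumeration. -/
theorem exists_labelCount_map_eq_add {N : ℤ} (hW : ∀ i, W (i + N) = W i) {a : V}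
    (ha : 0 < labelCount W a N - labelCount W a 0) (σ τ : ℤ → ℤ)
    (hσ : ∀ i, W (σ i) = W i) (hτ : ∀ i, W (τ i) = W i) (hστ : ∀ i, σ (τ i) = i)
    (hmono : ∀ i j, (W i).1 = a → (W j).1 = a → i < j → σ i < σ j) :
    ∃ m : ℤ, ∀ i, (W i).1 = a → labelCount W a (σ i) = labelCount W a i + m := by
  choose e he hex using exists_labelCount_eq hW ha
  have hee : ∀ i, (W i).1 = a → e (labelCount W a i) = i := fun i hi =>
    eq_of_labelCount_eq (he _) hi (hex _)
  have hstrict : StrictMono fun x => labelCount W a (σ (e x)) := by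
    intro x y hxy
    refine labelCount_lt (by rw [hσ, he]) (hmono _ _ (he x) (he y) ?_)
    apply lt_of_labelCount_lt (W := W) (a := a)
    rwa [hex, hex]
  have hsurj : Function.Surjective fun x => labelCount W a (σ (e x)) := by
    intro y
    refine ⟨labelCount W a (τ (e y)), ?_⟩
    simp only
    rw [hee _ (by rw [hτ, he]), hστ, hex]
  have hsucc : ∀ x, labelCount W a (σ (e (x + 1))) = labelCount W a (σ (e x)) + 1 := fun x =>
    OrderIso.map_succ (hstrict.orderIsoOfSurjective _ hsurj) x
  have htrans : ∀ x, labelCount W a (σ (e x)) = x + labelCount W a (σ (e 0)) := by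
    intro x
    induction x using Int.induction_on with
    | zero => simp
    | succ x ih => rw [hsucc, ih]; ring
    | pred x ih =>
      have := hsucc (-(x : ℤ) - 1)
      rw [sub_add_cancel, ih] at this
      linarith
  refine ⟨labelCount W a (σ (e 0)), fun i hi => ?_⟩
  have := htrans (labelCount W a i)
  rwa [hee i hi] at this

/-- A partial order-reversing and sign-reversing correspondence between the positions of a
reduced path cannot exchange two positions. -/
theorem not_exchange (T : ℤ → ℤ) (hT : ∀ i, W (T i) = W i)
    (hmono : ∀ i j, ¬ Γ.Adj (W j).1 (W i).1 → i < j → T i < T j)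
    (hred : ∀ i j, i < j → (W i).1 = (W j).1 → (W i).2 ≠ (W j).2 →
      ∃ k, i < k ∧ k < j ∧ ¬ Γ.Adj (W i).1 (W k).1)
    {c s t : ℤ} (hrev : ∀ i, s ≤ i → i < t → W (c - i) = ((W i).1, !(W i).2)) :
    ∀ d : ℕ, ∀ p q : ℤ, q - p = d → s ≤ T p → T q < t → c - T p = q → c - T q = p → False := by
  intro d
  induction d using Nat.strong_induction_on with
  | _ d ih =>
  intro p q hpq hp hq hpq' hqp'
  have hTpq : T p ≤ T q := by lia
  have hWq : W q = ((W p).1, !(W p).2) := by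
    rw [← hpq', hrev _ hp (by lia), hT]
  have hlt : p < q := by
    rcases (show p ≤ q by lia).lt_or_eq with h | h
    · exact h
    · rw [← h] at hWq
      have := congrArg Prod.snd hWq
      simp at this
  obtain ⟨r, hr1, hr2, hr⟩ := hred p q hlt (by rw [hWq]) (by rw [hWq]; simp)
  have hlab : (W q).1 = (W p).1 := by rw [hWq]
  have hQ : ∀ x, p < x → x < q → (W x).1 = (W r).1 →
      s ≤ T x ∧ T x < t ∧ p < c - T x ∧ c - T x < q ∧ (W (c - T x)).1 = (W r).1 := by
    intro x h1 h2 h3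
    have h4 := hmono p x (by rw [h3]; exact fun h => hr h.symm) h1
    have h5 := hmono x q (by rw [h3, hlab]; exact hr) h2
    refine ⟨by lia, by lia, by lia, by lia, ?_⟩
    rw [hrev _ (by lia) (by lia), hT, ← h3]
  classical
  set Q := (Finset.Ioo p q).filter fun x => (W x).1 = (W r).1 with hQdef
  have hmem : ∀ x, x ∈ Q ↔ p < x ∧ x < q ∧ (W x).1 = (W r).1 := by
    intro x; simp [hQdef, and_assoc]
  have hne : Q.Nonempty := ⟨r, (hmem r).2 ⟨hr1, hr2, rfl⟩⟩
  have hmaps : ∀ x ∈ Q, c - T x ∈ Q := by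
    intro x hx
    obtain ⟨h1, h2, h3⟩ := (hmem x).1 hx
    exact (hmem _).2 (hQ x h1 h2 h3).2.2
  have hanti : ∀ x ∈ Q, ∀ y ∈ Q, x < y → c - T y < c - T x := by
    intro x hx y hy hxy
    have hxy' : ¬ Γ.Adj (W y).1 (W x).1 := by
      rw [((hmem x).1 hx).2.2, ((hmem y).1 hy).2.2]
      exact Γ.loopless.irrefl _
    have := hmono x y hxy' hxy
    lia
  have hsurj : ∀ y ∈ Q, ∃ x ∈ Q, c - T x = y := by
    have hinj : Set.InjOn (fun x => c - T x) Q := by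
      intro x hx y hy hxy
      by_contra hne'
      rcases lt_or_gt_of_ne hne' with h | h
      · exact (hanti x hx y hy h).ne' hxy
      · exact (hanti y hy x hx h).ne hxy
    exact Finset.surjOn_of_injOn_of_card_le _ hmaps hinj le_rfl
  have hmin := Q.min'_mem hne
  have hmax := Q.max'_mem hne
  have e1 : c - T (Q.min' hne) = Q.max' hne := by
    obtain ⟨x, hx, hxe⟩ := hsurj _ hmax
    rcases (Q.min'_le x hx).lt_or_eq with h | h
    · have h1 := hanti _ hmin x hx h
      have h2 := Q.le_max' _ (hmaps _ hmin)
      lia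
    · rw [h, hxe]
  have e2 : c - T (Q.max' hne) = Q.min' hne := by
    obtain ⟨x, hx, hxe⟩ := hsurj _ hmin
    rcases (Q.le_max' x hx).lt_or_eq with h | h
    · have h1 := hanti x hx _ hmax h
      have h2 := Q.min'_le _ (hmaps _ hmax)
      lia
    · rw [← h, hxe]
  have hle := Q.min'_le _ hmax
  obtain ⟨a1, a2, a3⟩ := (hmem _).1 hmin
  obtain ⟨b1, b2, b3⟩ := (hmem _).1 hmax
  exact ih (Q.max' hne - Q.min' hne).toNat (by lia) _ _ (by lia)
    (hQ _ a1 a2 a3).1 (hQ _ b1 b2 b3).2.1 e1 e2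

theorem labelCount_add_labelCount_rev {a : V} {i₀ j₀ : ℤ} {l : ℕ}
    (hrev : ∀ i, i₀ ≤ i → i < i₀ + l →
      W (i₀ + j₀ + l - 1 - i) = ((W i).1, !(W i).2)) (k : ℕ) (hk : k ≤ l) :
    labelCount W a (i₀ + k) + labelCount W a (j₀ + l - k) =
      labelCount W a i₀ + labelCount W a (j₀ + l) := by
  induction k with
  | zero => simp
  | succ k ih =>
    have h := hrev (i₀ + k) (by lia) (by lia)
    have h1 := labelCount_succ (W := W) a (i₀ + k)
    have h2 := labelCount_succ (W := W) a (j₀ + l - k - 1)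
    rw [show i₀ + j₀ + l - 1 - (i₀ + k) = j₀ + l - k - 1 by ring] at h
    rw [h, sub_add_cancel] at h2
    have := ih (by lia)
    push_cast
    rw [← add_assoc, ← sub_sub]
    simp only at h2
    linarith

theorem two_mul_labelCount_le {N : ℤ} (hW : ∀ i, W (i + N) = W i) {n : ℕ} (hn : 0 < n)
    (σ : ℤ → ℤ → ℤ) (hσ0 : ∀ i, σ 0 i = i) (hσadd : ∀ m m' i, σ (m + m') i = σ m (σ m' i))
    (hσn : ∀ i, σ n i = i + N) (hσW : ∀ m i, W (σ m i) = W i)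
    (hmono : ∀ m i j, ¬ Γ.Adj (W j).1 (W i).1 → i < j → σ m i < σ m j)
    (hred : ∀ i j, i < j → (W i).1 = (W j).1 → (W i).2 ≠ (W j).2 →
      ∃ k, i < k ∧ k < j ∧ ¬ Γ.Adj (W i).1 (W k).1)
    {i₀ j₀ : ℤ} {l : ℕ} (hN : 0 < N)
    (hrev : ∀ i, i₀ ≤ i → i < i₀ + l →
      W (i₀ + j₀ + l - 1 - i) = ((W i).1, !(W i).2)) (a : V) :
    2 * n * (labelCount W a (i₀ + l) - labelCount W a i₀) ≤
      labelCount W a N - labelCount W a 0 := by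
  set M := labelCount W a N - labelCount W a 0 with hM
  set k := labelCount W a (i₀ + l) - labelCount W a i₀ with hk
  rcases le_or_gt k 0 with hk0 | hk0
  · have h1 : 0 ≤ M := by
      have := labelCount_mono (W := W) a hN.le
      lia
    have : (0 : ℤ) ≤ n := by lia
    nlinarith
  have hMpos : 0 < M := by
    by_contra h
    have h1 := labelCount_add_mul hW a i₀ l
    have h2 := labelCount_mono (W := W) a (show i₀ + l ≤ i₀ + l * N by nlinarith)
    rw [← hM] at h1
    have : (0 : ℤ) ≤ l := by lia
    nlinarith
  obtain ⟨m, hm⟩ := exists_labelCount_map_eq_add hW hMpos (σ 1) (σ (-1)) (hσW 1) (hσW (-1))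
    (fun i => by rw [← hσadd, add_neg_cancel, hσ0])
    (fun i j hi hj hij => hmono 1 i j (by rw [hi, hj]; exact Γ.loopless.irrefl a) hij)
  have hmt : ∀ t i, (W i).1 = a → labelCount W a (σ t i) = labelCount W a i + t * m := by
    intro t
    induction t using Int.induction_on with
    | zero => intro i _; simp [hσ0]
    | succ t ih =>
      intro i hi
      rw [add_comm (t : ℤ) 1, hσadd, hm _ (by rw [hσW, hi]), ih i hi]
      ring
    | pred t ih =>
      intro i hi
      have h1 := hm (σ (-(t : ℤ) - 1) i) (by rw [hσW, hi])
      rw [← hσadd, add_sub_cancel, ih i hi] at h1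
      linarith
  obtain ⟨i₁, hi₁, -⟩ := exists_labelCount_eq hW hMpos 0
  have hnm : M = n * m := by
    have h1 := hmt n i₁ hi₁
    rw [hσn, labelCount_add hW] at h1
    lia
  have hnpos : (0 : ℤ) < n := by lia
  have hmpos : 0 < m := by
    by_contra h
    nlinarith
  suffices h : 2 * k ≤ m by
    rw [hnm]
    nlinarith
  by_contra! hlt
  obtain ⟨s, hs⟩ : ∃ s, s = labelCount W a i₀ := ⟨_, rfl⟩
  obtain ⟨s', hs'⟩ : ∃ s', s' = labelCount W a j₀ := ⟨_, rfl⟩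
  have hs'k : labelCount W a (j₀ + l) = s' + k := by
    have := labelCount_add_labelCount_rev (a := a) hrev l le_rfl
    rw [add_sub_cancel_right] at this
    lia
  obtain ⟨j, hj1, hj2⟩ : ∃ j, s + j * m ≤ s' + k - 1 ∧ s' ≤ s + j * m + k - 1 := by
    have h1 := Int.mul_ediv_add_emod (s' - s) m
    have h2 := Int.emod_nonneg (s' - s) hmpos.ne'
    have h3 := Int.emod_lt_of_pos (s' - s) hmpos
    rcases le_or_gt ((s' - s) % m) (k - 1) with h4 | h4
    · exact ⟨(s' - s) / m, by linarith, by linarith⟩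
    · refine ⟨(s' - s) / m + 1, ?_, ?_⟩ <;> rw [add_mul, one_mul] <;> lia
  obtain ⟨A, hA⟩ : ∃ A, A = s + j * m := ⟨_, rfl⟩
  rw [← hA] at hj1 hj2
  obtain ⟨x, y, hxy, hsum, hx, hy⟩ : ∃ x y, x ≤ y ∧ x + y = A + s' + k - 1 ∧
      A ≤ x ∧ y < A + k := by
    refine ⟨(A + s' + k - 1) / 2, A + s' + k - 1 - (A + s' + k - 1) / 2, ?_, ?_, ?_, ?_⟩ <;> lia
  obtain ⟨p, hpa, hp⟩ := exists_labelCount_eq hW hMpos x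
  obtain ⟨q, hqa, hq⟩ := exists_labelCount_eq hW hMpos y
  have hflip : ∀ z p q, (W p).1 = a → (W q).1 = a → labelCount W a p = z →
      labelCount W a q = A + s' + k - 1 - z → A ≤ z → z < A + k →
      i₀ ≤ σ (-j) p ∧ σ (-j) p < i₀ + l ∧ i₀ + j₀ + l - 1 - σ (-j) p = q := by
    intro z p q hpa hqa hp hq hz1 hz2
    have e := hmt (-j) p hpa
    rw [hp] at e
    have hl := hσW (-j) p
    have h1 : i₀ ≤ σ (-j) p := by
      by_contra h
      have := labelCount_lt (W := W) (a := a) (by rw [hl, hpa]) (not_le.1 h)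
      lia
    have h2 : σ (-j) p < i₀ + l := by
      apply lt_of_labelCount_lt (W := W) (a := a)
      lia
    refine ⟨h1, h2, ?_⟩
    have hw := hrev _ h1 h2
    apply eq_of_labelCount_eq (W := W) (a := a) (by rw [hw, hl, hpa]) hqa
    obtain ⟨t, ht⟩ : ∃ t : ℕ, (t : ℤ) = σ (-j) p - i₀ := ⟨(σ (-j) p - i₀).toNat, by lia⟩
    have h3 := labelCount_add_labelCount_rev (a := a) hrev (t + 1) (by lia)
    have h4 := labelCount_succ_of_eq (W := W) (a := a) (i := σ (-j) p) (by rw [hl, hpa])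
    push_cast at h3
    rw [show i₀ + ((t : ℤ) + 1) = σ (-j) p + 1 by lia,
      show j₀ + (l : ℤ) - (t + 1) = i₀ + j₀ + l - 1 - σ (-j) p by lia] at h3
    lia
  obtain ⟨p1, p2, p3⟩ := hflip x p q hpa hqa hp (by lia) hx (by lia)
  obtain ⟨q1, q2, q3⟩ := hflip y q p hqa hpa hq (by lia) (by lia) hy
  have hpq : p ≤ q := by
    by_contra h
    have := labelCount_lt (W := W) (a := a) hqa (not_le.1 h)
    lia
  exact not_exchange (σ (-j)) (hσW (-j)) (hmono (-j)) hred hrev (q - p).toNat p q (by lia)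
    p1 q2 p3 q3

end Combinatorics

section PeriodicPath

/-- The bi-infinite periodic word with period `w`. -/
def periodicWord (w : List (V × Bool)) (hw : 0 < w.length) (i : ℤ) : V × Bool :=
  w[(i % w.length).toNat]'(by
    have := Int.emod_lt_of_pos i (show (0 : ℤ) < w.length by lia)
    lia)

/-- The bi-infinite path through the identity spelling the periodic word with period `w`. -/
def periodicPath (Γ : SimpleGraph V) (w : List (V × Bool)) (i : ℤ) : RAAG Γ :=
  spellRAAG Γ w ^ (i / w.length) * spellRAAG Γ (w.take (i % w.length).toNat)

variable {w : List (V × Bool)} (hw : 0 < w.length)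

theorem periodicWord_natCast (i : ℕ) :
    periodicWord w hw i = w[i % w.length]'(Nat.mod_lt _ hw) := by
  unfold periodicWord
  congr 1

theorem periodicWord_add_length (i : ℤ) :
    periodicWord w hw (i + w.length) = periodicWord w hw i := by
  unfold periodicWord
  simp only [Int.add_emod_right]

theorem periodicPath_zero : periodicPath Γ w 0 = 1 := by
  simp [periodicPath, spellRAAG_nil]

include hw in
theorem periodicPath_add_length (i : ℤ) :
    periodicPath Γ w (i + w.length) = spellRAAG Γ w * periodicPath Γ w i := by
  unfold periodicPath
  rw [Int.add_emod_right, Int.add_ediv_of_dvd_right (dvd_refl _), Int.ediv_self (by lia),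
    add_comm, zpow_one_add, mul_assoc]

theorem periodicPath_succ (i : ℤ) :
    periodicPath Γ w (i + 1) = periodicPath Γ w i * letter Γ (periodicWord w hw i) := by
  have hpos : (0 : ℤ) < w.length := by lia
  have h0 := Int.emod_nonneg i hpos.ne'
  have h1 := Int.emod_lt_of_pos i hpos
  have h2 := Int.mul_ediv_add_emod i w.length
  obtain ⟨r, hr⟩ : ∃ r : ℕ, (r : ℤ) = i % w.length := ⟨(i % w.length).toNat, by lia⟩
  have hrw : r < w.length := by lia
  have htake : spellRAAG Γ (w.take r) * letter Γ (periodicWord w hw i) =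
      spellRAAG Γ (w.take (r + 1)) := by
    rw [← spellRAAG_singleton, ← spellRAAG_append, List.take_succ_eq_append_getElem hrw]
    unfold periodicWord
    simp only [← hr, Int.toNat_natCast]
  unfold periodicPath
  rw [mul_assoc, ← hr, Int.toNat_natCast, htake]
  rcases (show r + 1 ≤ w.length by lia).lt_or_eq with h | h
  · have e1 : (i + 1) / w.length = i / w.length :=
      ((Int.ediv_emod_unique (r := (r + 1 : ℕ)) hpos).2 ⟨by lia, by lia, by lia⟩).1
    have e2 : (i + 1) % w.length = (r + 1 : ℕ) :=
      ((Int.ediv_emod_unique (q := i / w.length) hpos).2 ⟨by lia, by lia, by lia⟩).2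
    rw [e1, e2, Int.toNat_natCast]
  · have e0 : (w.length : ℤ) * (i / w.length + 1) = w.length * (i / w.length) + w.length := by
      ring
    have e1 : (i + 1) / w.length = i / w.length + 1 :=
      ((Int.ediv_emod_unique (r := 0) hpos).2 ⟨by lia, by lia, by lia⟩).1
    have e2 : (i + 1) % w.length = 0 :=
      ((Int.ediv_emod_unique (q := i / w.length + 1) hpos).2 ⟨by lia, by lia, by lia⟩).2
    rw [e1, e2, h, List.take_length, zpow_add_one, Int.toNat_zero, List.take_zero, spellRAAG_nil,
      mul_one]

theorem exists_periodicWord_eq_of_isCyclicSubword {u : List (V × Bool)}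
    (hu : IsCyclicSubword u w) :
    ∃ i₀ : ℕ, ∀ (t : ℕ) (ht : t < u.length), periodicWord w hw (i₀ + t : ℕ) = u[t] := by
  obtain ⟨k, p, s, hps⟩ := hu
  refine ⟨p.length + k, fun t ht => ?_⟩
  have hlen : p.length + t < (w.rotate k).length := by
    rw [← hps]; simp; lia
  have h1 := List.getElem_rotate w k (p.length + t) hlen
  rw [periodicWord_natCast]
  simp only [← hps, List.append_assoc] at h1
  rw [List.getElem_append_right (by lia), List.getElem_append_left (by lia)] at h1
  simp only [add_tsub_cancel_left] at h1
  rw [h1]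
  simp only [add_right_comm]

theorem length_wordInv (u : List (V × Bool)) : (wordInv u).length = u.length := by
  simp [wordInv]

theorem getElem_wordInv (u : List (V × Bool)) {t : ℕ} (ht : t < (wordInv u).length) :
    (wordInv u)[t] = ((u[u.length - 1 - t]'(by rw [length_wordInv] at ht; lia)).1,
      !(u[u.length - 1 - t]'(by rw [length_wordInv] at ht; lia)).2) := by
  simp [wordInv, List.getElem_reverse]

end PeriodicPath

/-- A subword of the label of an axis of `g ^ n` whose inverse is also a subword has length at
most half the translation length of `g`. -/
theorem two_mul_length_le [Fintype V] {X : ℤ → RAAG Γ} {W : ℤ → V × Bool} {N : ℕ} {g : RAAG Γ}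
    {n : ℕ} (hn : 0 < n) (hX : ∀ i, X (i + 1) = X i * letter Γ (W i)) (hN : 0 < N)
    (hW : ∀ i, W (i + N) = W i) (hω : ∀ i, X (i + N) = g ^ n * X i) (hX0 : X 0 = 1)
    (hinj : Function.Injective (dualHyperplane X W)) {i₀ j₀ : ℤ} {l : ℕ}
    (hrev : ∀ i, i₀ ≤ i → i < i₀ + l →
      W (i₀ + j₀ + l - 1 - i) = ((W i).1, !(W i).2)) :
    2 * n * l ≤ N := by
  have hg : ∀ m : ℤ, Commute (g ^ m) (g ^ n) := fun m =>
    ((Commute.refl g).zpow_left m).pow_right n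
  choose σ hσ hσW using fun m : ℤ =>
    exists_smul_dualHyperplane_eq hX hN hW hω hX0 hinj (hg m)
  have hmain := fun a => two_mul_labelCount_le (Γ := Γ) hW hn σ
    (fun i => hinj (by rw [← hσ, zpow_zero, one_smul]))
    (fun m m' i => hinj (by rw [← hσ, ← hσ, ← hσ, zpow_add, mul_smul]))
    (fun i => hinj (by rw [← hσ, zpow_natCast, dualHyperplane_add hW hω]))
    hσW
    (fun m i j hadj hij => lt_of_smul_dualHyperplane_eq hX hN hW hω hX0 hinj (hg m) (hσ m i)
      (hσ m j) hij hadj)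
    (fun i j hij h1 h2 => by
      by_contra! h
      exact hij.ne (hinj (dualHyperplane_eq_of_forall_adj hX hij h1 h2 h)))
    (by lia) hrev a
  have hsum := Finset.sum_le_sum fun a (_ : a ∈ Finset.univ) => hmain a
  have hper := sum_labelCount_sub (W := W) 0 N
  rw [zero_add] at hper
  rw [← Finset.mul_sum, sum_labelCount_sub, hper] at hsum
  exact_mod_cast hsum

theorem exists_pow_eq_of_isConj {G : Type*} [Group G] {g h : G} {n : ℕ} (hgh : IsConj (g ^ n) h) :
    ∃ g', g' ^ n = h := by
  obtain ⟨c, hc⟩ := isConj_iff.1 hgh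
  exact ⟨c * g * c⁻¹, by rw [conj_pow, hc]⟩

theorem two_mul_length_le_of_isCyclicSubword [Fintype V] {g : RAAG Γ} {n : ℕ} (hn : 0 < n)
    {w : List (V × Bool)} (hw : IsConj (g ^ n) (spellRAAG Γ w))
    (hcr : ∀ w', IsConj (spellRAAG Γ w) (spellRAAG Γ w') → w.length ≤ w'.length)
    {u : List (V × Bool)} (hu : IsCyclicSubword u w) (hu' : IsCyclicSubword (wordInv u) w) :
    2 * n * u.length ≤ w.length := by
  rcases Nat.eq_zero_or_pos w.length with h0 | hpos
  · obtain ⟨k, hk⟩ := hu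
    have := hk.length_le
    rw [List.length_rotate, h0, Nat.le_zero] at this
    simp [this]
  obtain ⟨g', hg'⟩ := exists_pow_eq_of_isConj hw
  obtain ⟨i₀, hi₀⟩ := exists_periodicWord_eq_of_isCyclicSubword hpos hu
  obtain ⟨j₀, hj₀⟩ := exists_periodicWord_eq_of_isCyclicSubword hpos hu'
  have hX := periodicPath_succ (Γ := Γ) hpos
  have hω := periodicPath_add_length (Γ := Γ) hpos
  have hW := periodicWord_add_length hpos
  refine two_mul_length_le (i₀ := i₀) (j₀ := j₀) hn hX hpos hW
    (fun i => by rw [hg', hω]) periodicPath_zero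
    (dualHyperplane_injective hX hpos hW fun i w' h => hcr w' (IsConj.trans ?_ h)) ?_
  · exact isConj_iff.2 ⟨(periodicPath Γ w i)⁻¹, by rw [hω, inv_inv, mul_assoc]⟩
  · intro i h1 h2
    obtain ⟨t, ht⟩ : ∃ t : ℕ, i = (i₀ + t : ℕ) := ⟨(i - i₀).toNat, by lia⟩
    have htl : t < u.length := by lia
    have hs : u.length - 1 - t < (wordInv u).length := by rw [length_wordInv]; lia
    have hi := hi₀ t htl
    rw [← ht] at hi
    have e := hj₀ _ hs
    rw [getElem_wordInv] at e
    simp only [show u.length - 1 - (u.length - 1 - t) = t by lia] at e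
    rw [show (i₀ : ℤ) + j₀ + u.length - 1 - i = (j₀ + (u.length - 1 - t) : ℕ) by lia, e, hi]

end RAAG

theorem subword_length_le_of_cyclically_reduced
    {V : Type*} [Fintype V] (Γ : SimpleGraph V) (g : RAAG Γ)
    (n : ℕ) (hn : 0 < n) (w : List (V × Bool))
    -- `w` represents the conjugacy class of `g ^ n`:
    (hw : IsConj (g ^ n) (spellRAAG Γ w))
    -- `w` is cyclically reduced: it has minimal length among all words
    -- representing the conjugacy class of the element it spells:
    (hcr : ∀ w' : List (V × Bool),
      IsConj (spellRAAG Γ w) (spellRAAG Γ w') → w.length ≤ w'.length)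
    (u : List (V × Bool))
    (hu : IsCyclicSubword u w) (hu' : IsCyclicSubword (wordInv u) w) :
    (u.length : ℝ) ≤ (w.length : ℝ) / (2 * n) := by
  have h := RAAG.two_mul_length_le_of_isCyclicSubword hn hw hcr hu hu'
  have hn0 : (0 : ℝ) < 2 * n := by positivity
  rw [le_div_iff₀ hn0, mul_comm]
  exact_mod_cast h
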